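/- arXiv:2208.07865 — 4 statements merged into one kernel-verified Lean document; each statement's English description precedes it below -/
import Mathlib

section
/- For each fourth root of unity ζ ∈ {1, −1, i, −i}, set α_ζ(a,b,c) = (ζ²)^{abc} and β_ζ(a,b) = ζ^{ab} for a,b,c ∈ ℤ/2ℤ (using the representatives in {0,1} as exponents). Then the four pairs (α_ζ, β_ζ) are abelian 3-cocycles on ℤ/2ℤ with values in ℂˣ, and for ζ ≠ ζ′ the abelian 3-cocycles (α_ζ, β_ζ) and (α_{ζ′}, β_{ζ′}) are not cohomologous. -/
/-- A 3-cochain `α : (ℤ/2)³ → ℂˣ` is a 3-cocycle (for the trivial action). -/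
def IsCocycle₃ (α : ZMod 2 → ZMod 2 → ZMod 2 → ℂˣ) : Prop :=
  ∀ a b c d : ZMod 2,
    α b c d * (α (a + b) c d)⁻¹ * α a (b + c) d * (α a b (c + d))⁻¹ * α a b c = 1

/-- `(α, β)` is an abelian 3-cocycle on ℤ/2 with values in ℂˣ: `α` is a 3-cocycle and the
two hexagon equations hold. -/
def IsAbelian3Cocycle (α : ZMod 2 → ZMod 2 → ZMod 2 → ℂˣ)
    (β : ZMod 2 → ZMod 2 → ℂˣ) : Prop :=
  IsCocycle₃ α ∧
    (∀ a b c : ZMod 2, β (a + b) c * α a b c * α c a b = α a c b * β a c * β b c) ∧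
    (∀ a b c : ZMod 2, β a (b + c) * α a b c * α b c a = α b a c * β a b * β a c)

/-- Two abelian 3-cocycles `(α, β)` and `(α′, β′)` are cohomologous if they differ by the
coboundary of a 2-cochain `σ`. -/
def AbelianCocyclesCohomologous
    (α : ZMod 2 → ZMod 2 → ZMod 2 → ℂˣ) (β : ZMod 2 → ZMod 2 → ℂˣ)
    (α' : ZMod 2 → ZMod 2 → ZMod 2 → ℂˣ) (β' : ZMod 2 → ZMod 2 → ℂˣ) : Prop :=
  ∃ σ : ZMod 2 → ZMod 2 → ℂˣ,
    (∀ a b c : ZMod 2,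
      α' a b c = α a b c * (σ b c * (σ (a + b) c)⁻¹ * σ a (b + c) * (σ a b)⁻¹)) ∧
    (∀ a b : ZMod 2, β' a b = β a b * (σ a b * (σ b a)⁻¹))

/-- The abelian 3-cocycle `(α_ζ, β_ζ)` attached to a fourth root of unity `ζ`:
`α_ζ(a,b,c) = (ζ²)^{abc}` and `β_ζ(a,b) = ζ^{ab}`. -/
noncomputable def αζ (ζ : ℂˣ) : ZMod 2 → ZMod 2 → ZMod 2 → ℂˣ :=
  fun a b c => (ζ ^ 2) ^ (a.val * b.val * c.val)

noncomputable def βζ (ζ : ℂˣ) : ZMod 2 → ZMod 2 → ℂˣ :=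
  fun a b => ζ ^ (a.val * b.val)

/-- The pair `(α_ζ, β_ζ)` is an abelian 3-cocycle as soon as `ζ ^ 4 = 1`. -/
theorem isAbelian3Cocycle_of_pow_four_eq_one {ζ : ℂˣ} (h : ζ ^ 4 = 1) :
    IsAbelian3Cocycle (αζ ζ) (βζ ζ) := by
  have hsq : ζ ^ 2 * ζ ^ 2 = 1 := by rw [← pow_add, h]
  have hinv : (ζ ^ 2)⁻¹ = ζ ^ 2 := inv_eq_of_mul_eq_one_left hsq
  have h11 : (1 + 1 : ZMod 2) = 0 := rfl
  have h2 (a : ZMod 2) : a = 0 ∨ a = 1 := by revert a; decide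
  refine ⟨fun a b c d => ?_, fun a b c => ?_, fun a b c => ?_⟩
  · rcases h2 a with rfl | rfl <;> rcases h2 b with rfl | rfl <;> rcases h2 c with rfl | rfl <;>
      rcases h2 d with rfl | rfl <;> simp [αζ, h11, hinv, hsq, ZMod.val_one]
  all_goals
    rcases h2 a with rfl | rfl <;> rcases h2 b with rfl | rfl <;> rcases h2 c with rfl | rfl <;>
      simp [αζ, βζ, h11, ZMod.val_one, mul_assoc, ← sq]

/-- The restriction of `β` to the diagonal only depends on the class of `(α, β)`. -/
theorem AbelianCocyclesCohomologous.apply_self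
    {α α' : ZMod 2 → ZMod 2 → ZMod 2 → ℂˣ} {β β' : ZMod 2 → ZMod 2 → ℂˣ}
    (h : AbelianCocyclesCohomologous α β α' β') (a : ZMod 2) : β a a = β' a a := by
  obtain ⟨σ, -, hσ⟩ := h
  simp [hσ a a]

/-- For each fourth root of unity `ζ ∈ {1, −1, i, −i}`, the pair `(α_ζ, β_ζ)` is an abelian
3-cocycle on ℤ/2 with values in ℂˣ, and for `ζ ≠ ζ′` the abelian 3-cocycles `(α_ζ, β_ζ)`
and `(α_{ζ′}, β_{ζ′})` are not cohomologous. -/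
theorem four_boundary_terminations_distinct (ζ ζ' : ℂˣ)
    (hζ : (ζ : ℂ) = 1 ∨ (ζ : ℂ) = -1 ∨ (ζ : ℂ) = Complex.I ∨ (ζ : ℂ) = -Complex.I)
    (hζ' : (ζ' : ℂ) = 1 ∨ (ζ' : ℂ) = -1 ∨ (ζ' : ℂ) = Complex.I ∨ (ζ' : ℂ) = -Complex.I) :
    IsAbelian3Cocycle (αζ ζ) (βζ ζ) ∧
      (ζ ≠ ζ' → ¬ AbelianCocyclesCohomologous (αζ ζ) (βζ ζ) (αζ ζ') (βζ ζ')) := by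
  have h4 : ζ ^ 4 = 1 := by
    ext
    push_cast
    rcases hζ with h | h | h | h <;> simp [h, Even.neg_pow (by decide : Even 4)]
  refine ⟨isAbelian3Cocycle_of_pow_four_eq_one h4, fun hne h => hne ?_⟩
  simpa [βζ, ZMod.val_one] using h.apply_self 1
end

section
/- Let (α, β) be a normalized abelian 3-cocycle on ℤ/2ℤ with values in ℂˣ, meaning: α is a 3-cocycle, (α, β) satisfies the two hexagon equations, α(a,b,c) = 1 whenever at least one of a,b,c equals 0, and β(a,0) = β(0,b) = 1 for all a,b. Then α(1,1,1)² = 1, β(1,1)² = α(1,1,1), and consequently β(1,1)⁴ = 1, so β(1,1) ∈ {1, −1, i, −i}. -/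
/-- Rigidity of normalized abelian 3-cocycles on ℤ/2: if `(α, β)` is an abelian 3-cocycle
with `α` normalized (`α(a,b,c) = 1` whenever one of the arguments is `0`) and `β`
normalized (`β(a,0) = β(0,b) = 1`), then `α(1,1,1)² = 1`, `β(1,1)² = α(1,1,1)`, hence
`β(1,1)⁴ = 1`, i.e. `β(1,1) ∈ {1, −1, i, −i}`. -/
theorem normalized_abelian_cocycle_rigidity
    (α : ZMod 2 → ZMod 2 → ZMod 2 → ℂˣ) (β : ZMod 2 → ZMod 2 → ℂˣ)
    (h : IsAbelian3Cocycle α β)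
    (hα : ∀ a b c : ZMod 2, a = 0 ∨ b = 0 ∨ c = 0 → α a b c = 1)
    (hβ : ∀ a b : ZMod 2, β a 0 = 1 ∧ β 0 b = 1) :
    α 1 1 1 ^ 2 = 1 ∧ β 1 1 ^ 2 = α 1 1 1 ∧ β 1 1 ^ 4 = 1 ∧
      ((β 1 1 : ℂ) = 1 ∨ (β 1 1 : ℂ) = -1 ∨ (β 1 1 : ℂ) = Complex.I ∨
        (β 1 1 : ℂ) = -Complex.I) := by
  obtain ⟨h₃, h₁, -⟩ := h
  have h11 : (1 : ZMod 2) + 1 = 0 := rfl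
  have hsq : α 1 1 1 ^ 2 = 1 := by
    simpa [h11, hα, sq] using h₃ 1 1 1 1
  have hβsq : β 1 1 ^ 2 = α 1 1 1 := by
    have := h₁ 1 1 1
    rw [h11, (hβ 0 1).2, one_mul, mul_assoc] at this
    rw [sq]
    exact (mul_left_cancel this).symm
  have hβ4 : β 1 1 ^ 4 = 1 := by
    rw [← hsq, ← hβsq, ← pow_mul]
  refine ⟨hsq, hβsq, hβ4, ?_⟩
  have hc : (β 1 1 : ℂ) ^ 4 = 1 := by
    simpa using congrArg Units.val hβ4
  have hfactor : ((β 1 1 : ℂ) ^ 2 - 1 ^ 2) * ((β 1 1 : ℂ) ^ 2 - Complex.I ^ 2) = 0 := by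
    rw [Complex.I_sq]
    linear_combination hc
  simpa only [mul_eq_zero, sub_eq_zero, sq_eq_sq_iff_eq_or_eq_neg, or_assoc] using hfactor
end

section
/- Let V₀ be a finite type of vertices, let E be the type of 2-element subsets of V₀, and consider the lattice space V = ((E → ℤ/2ℤ) → ℂ). For pairwise distinct vertices i, j, k, l ∈ V₀, with Δ(a,b,c) = {{a,b},{a,c},{b,c}} ⊆ E, the product of the plaquette operators over the four triangular faces of the tetrahedron on {i,j,k,l} is the identity: Z_{Δ(i,j,k)} ∘ Z_{Δ(i,j,l)} ∘ Z_{Δ(i,k,l)} ∘ Z_{Δ(j,k,l)} = id (equivalently, every edge of the tetrahedron lies in exactly two of its four faces). -/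
open Finset

/-- The Pauli phase (σ_z-string) operator `Z_S` on the lattice space `(E → ℤ/2) → ℂ`:
`(Z_S f)(s) = (−1)^{#{e ∈ S | s e = 1}} · f(s)`. -/
def Zop {E : Type*} (S : Finset E) :
    ((E → ZMod 2) → ℂ) →ₗ[ℂ] ((E → ZMod 2) → ℂ) where
  toFun f := fun s => (-1 : ℂ) ^ (S.filter fun e => s e = 1).card * f s
  map_add' f g := by funext s; simp [mul_add]
  map_smul' c f := by funext s; simp [smul_eq_mul]; ring

/-- The edges of the complete graph on `V₀`: 2-element subsets of `V₀`. -/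
abbrev Edge (V₀ : Type*) := {s : Finset V₀ // s.card = 2}

/-- The plaquette (triangle) `Δ(a,b,c) = {{a,b}, {a,c}, {b,c}}` on three vertices. -/
def triangle {V₀ : Type*} [Fintype V₀] [DecidableEq V₀] (a b c : V₀) :
    Finset (Edge V₀) :=
  Finset.univ.filter fun e => e.1 = {a, b} ∨ e.1 = {a, c} ∨ e.1 = {b, c}

/-- The eigenvalue of the Pauli operator `σ_z` at the site `e` in the spin configuration `s`. -/
def pauliSign {E : Type*} (s : E → ZMod 2) (e : E) : ℂ := if s e = 1 then -1 else 1

theorem pauliSign_mul_self {E : Type*} (s : E → ZMod 2) (e : E) :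
    pauliSign s e * pauliSign s e = 1 := by
  unfold pauliSign
  split_ifs <;> norm_num

theorem Zop_apply {E : Type*} (S : Finset E) (f : (E → ZMod 2) → ℂ) (s : E → ZMod 2) :
    Zop S f s = (∏ e ∈ S, pauliSign s e) * f s := by
  simp [Zop, pauliSign, Finset.prod_ite]

theorem triangle_eq {V₀ : Type*} [Fintype V₀] [DecidableEq V₀] {a b c : V₀}
    (hab : a ≠ b) (hac : a ≠ c) (hbc : b ≠ c) :
    triangle a b c =
      {⟨{a, b}, card_pair hab⟩, ⟨{a, c}, card_pair hac⟩, ⟨{b, c}, card_pair hbc⟩} := by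
  ext e
  simp [triangle, Subtype.ext_iff]

theorem prod_triangle {V₀ M : Type*} [Fintype V₀] [DecidableEq V₀] [CommMonoid M] {a b c : V₀}
    (hab : a ≠ b) (hac : a ≠ c) (hbc : b ≠ c) (g : Edge V₀ → M) :
    ∏ e ∈ triangle a b c, g e =
      g ⟨{a, b}, card_pair hab⟩ * (g ⟨{a, c}, card_pair hac⟩ * g ⟨{b, c}, card_pair hbc⟩) := by
  have pair_ne {u v x y : V₀} (hu : u ≠ x) (hv : u ≠ y) : ({u, v} : Finset V₀) ≠ {x, y} :=
    fun h => by
      have hmem : u ∈ ({x, y} : Finset V₀) := h ▸ mem_insert_self u {v}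
      simp [hu, hv] at hmem
  have h₁ : ({a, b} : Finset V₀) ≠ {a, c} := by
    rw [pair_comm a b]
    exact pair_ne hab.symm hbc
  rw [triangle_eq hab hac hbc, prod_insert, prod_insert, prod_singleton]
  · simpa [Subtype.ext_iff] using pair_ne hab hac
  · simpa [Subtype.ext_iff] using ⟨h₁, pair_ne hab hac⟩

/-- Tetrahedron constraint of the 3d toric code: the product of the four plaquette
operators over the faces of a tetrahedron on pairwise distinct vertices `i, j, k, l` is the
identity (every edge of the tetrahedron lies in exactly two of its four faces). -/
theorem tetrahedron_plaquette_product {V₀ : Type*} [Fintype V₀] [DecidableEq V₀]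
    (i j k l : V₀) (hij : i ≠ j) (hik : i ≠ k) (hil : i ≠ l)
    (hjk : j ≠ k) (hjl : j ≠ l) (hkl : k ≠ l) :
    Zop (triangle i j k) ∘ₗ Zop (triangle i j l) ∘ₗ Zop (triangle i k l) ∘ₗ
      Zop (triangle j k l) = LinearMap.id := by
  refine LinearMap.ext fun f => ?_
  funext s
  simp only [LinearMap.comp_apply, LinearMap.id_apply, Zop_apply, prod_triangle hij hik hjk,
    prod_triangle hij hil hjl, prod_triangle hik hil hkl, prod_triangle hjk hjl hkl]
  grind [pauliSign_mul_self]
end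

section
/- Let V₀ be a finite type of vertices, let E be the type of 2-element subsets of V₀, and consider the lattice space V = ((E → ℤ/2ℤ) → ℂ). Let n ≥ 1 and let v₀, v₁, …, vₙ ∈ V₀ be pairwise distinct, and let P = {{v₀,v₁}, {v₁,v₂}, …, {v_{n−1},vₙ}} ⊆ E be the edge set of the corresponding simple path. Then for every vertex v ∈ V₀, the vertex operator A_v := X_{star(v)} (with star(v) the set of edges containing v) satisfies: A_v ∘ Z_P = − Z_P ∘ A_v if v ∈ {v₀, vₙ}, and A_v ∘ Z_P = Z_P ∘ A_v otherwise. -/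
open Finset

/-- The Pauli flip (σₓ-string) operator `X_S` on the lattice space `(E → ℤ/2) → ℂ`:
`(X_S f)(s) = f(s + 𝟙_S)` where `𝟙_S` is the indicator configuration of `S`. -/
def Xop {E : Type*} [DecidableEq E] (S : Finset E) :
    ((E → ZMod 2) → ℂ) →ₗ[ℂ] ((E → ZMod 2) → ℂ) where
  toFun f := fun s => f (s + fun e => if e ∈ S then (1 : ZMod 2) else 0)
  map_add' _ _ := rfl
  map_smul' _ _ := rfl

/-- The star of a vertex `v`: the set of edges containing `v`. -/
def vertexStar {V₀ : Type*} [Fintype V₀] [DecidableEq V₀] (v : V₀) :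
    Finset (Edge V₀) :=
  Finset.univ.filter fun e => v ∈ e.1

/-- The edge set of the simple path `v₀ v₁ ⋯ vₙ`:
`P = {{v₀,v₁}, {v₁,v₂}, …, {v_{n−1},vₙ}}`. -/
def pathEdges {V₀ : Type*} [Fintype V₀] [DecidableEq V₀] {n : ℕ}
    (v : Fin (n + 1) → V₀) : Finset (Edge V₀) :=
  Finset.univ.filter fun e => ∃ i : Fin n, e.1 = {v i.castSucc, v i.succ}

theorem Zop_apply_eq_prod {E : Type*} (T : Finset E) (f : (E → ZMod 2) → ℂ) (s : E → ZMod 2) :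
    Zop T f s = (∏ e ∈ T, if s e = 1 then (-1 : ℂ) else 1) * f s := by
  simp [Zop, Finset.prod_ite]

/-- Flip and phase operators commute up to the sign `(-1) ^ #(S ∩ T)`, written as a product. -/
theorem Xop_comp_Zop {E : Type*} [DecidableEq E] (S T : Finset E) :
    Xop S ∘ₗ Zop T = (∏ e ∈ T, if e ∈ S then (-1 : ℂ) else 1) • (Zop T ∘ₗ Xop S) := by
  have hflip : ∀ a : ZMod 2, (a + 1 = 1) ↔ ¬ a = 1 := by decide
  refine LinearMap.ext fun f => funext fun s => ?_
  change Zop T f (s + fun e => if e ∈ S then (1 : ZMod 2) else 0) = _ * Zop T (Xop S f) s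
  rw [Zop_apply_eq_prod, Zop_apply_eq_prod, ← mul_assoc, ← Finset.prod_mul_distrib]
  change _ * f _ = _ * f _
  congr 1
  refine Finset.prod_congr rfl fun e _ => ?_
  by_cases he : e ∈ S <;> by_cases hs : s e = 1 <;> simp [he, hs, hflip]

theorem prod_pathEdges {V₀ M : Type*} [Fintype V₀] [DecidableEq V₀] [CommMonoid M] {n : ℕ}
    {v : Fin (n + 1) → V₀} (hv : Function.Injective v) (F : Finset V₀ → M) :
    ∏ e ∈ pathEdges v, F e.1 = ∏ i : Fin n, F {v i.castSucc, v i.succ} := by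
  have hne (i : Fin n) : v i.castSucc ≠ v i.succ := hv.ne i.castSucc_lt_succ.ne
  symm
  refine Finset.prod_bij (fun i _ => ⟨{v i.castSucc, v i.succ}, Finset.card_pair (hne i)⟩)
    ?_ ?_ ?_ ?_
  · intro i _
    simp only [pathEdges, Finset.mem_filter, Finset.mem_univ, true_and]
    exact ⟨i, rfl⟩
  · intro i _ j _ hij
    have hset : ({v i.castSucc, v i.succ} : Finset V₀) = {v j.castSucc, v j.succ} :=
      congrArg Subtype.val hij
    have h₁ : v i.castSucc ∈ ({v j.castSucc, v j.succ} : Finset V₀) := by simp [← hset]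
    have h₂ : v i.succ ∈ ({v j.castSucc, v j.succ} : Finset V₀) := by simp [← hset]
    simp only [Finset.mem_insert, Finset.mem_singleton, hv.eq_iff, Fin.ext_iff,
      Fin.val_castSucc, Fin.val_succ] at h₁ h₂
    ext
    omega
  · intro e he
    simp only [pathEdges, Finset.mem_filter, Finset.mem_univ, true_and] at he
    obtain ⟨i, hi⟩ := he
    exact ⟨i, Finset.mem_univ i, Subtype.ext hi.symm⟩
  · intro i _
    rfl

/-- The sign picked up by a vertex operator along a simple path only depends on the end points. -/
theorem prod_sign_pathEdges {V₀ : Type*} [Fintype V₀] [DecidableEq V₀] {n : ℕ}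
    {v : Fin (n + 1) → V₀} (hv : Function.Injective v) (w : V₀) :
    (∏ e ∈ pathEdges v, if e ∈ vertexStar w then (-1 : ℂ) else 1) =
      (if w = v 0 then -1 else 1) * (if w = v (Fin.last n) then -1 else 1) := by
  set g : Fin (n + 1) → ℂ := fun j => if w = v j then -1 else 1 with hg
  have hgg (j : Fin (n + 1)) : g j * g j = 1 := by
    simp only [hg]
    split_ifs <;> norm_num
  have hpair (i : Fin n) :
      (if w ∈ ({v i.castSucc, v i.succ} : Finset V₀) then (-1 : ℂ) else 1) =
        g i.castSucc * g i.succ := by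
    have hne : v i.castSucc ≠ v i.succ := hv.ne i.castSucc_lt_succ.ne
    by_cases h₁ : w = v i.castSucc
    · subst h₁
      simp [hg, hne]
    · simp [hg, h₁]
  have hsq : (∏ j, g j) * ∏ j, g j = 1 := by
    rw [← Finset.prod_mul_distrib]
    exact Finset.prod_eq_one fun j _ => hgg j
  have hfirst := Fin.prod_univ_succ g
  have hlast := Fin.prod_univ_castSucc g
  have hstar : (∏ e ∈ pathEdges v, if e ∈ vertexStar w then (-1 : ℂ) else 1) =
      (∏ i : Fin n, g i.castSucc) * ∏ i : Fin n, g i.succ := by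
    rw [← Finset.prod_mul_distrib, ← Finset.prod_congr rfl fun i _ => hpair i,
      ← prod_pathEdges hv fun t => if w ∈ t then (-1 : ℂ) else 1]
    simp [vertexStar]
  rw [hstar]
  change _ = g 0 * g (Fin.last n)
  have hA : ∏ i : Fin n, g i.castSucc = (∏ j, g j) * g (Fin.last n) := by
    rw [hlast, mul_assoc, hgg, mul_one]
  have hB : ∏ i : Fin n, g i.succ = g 0 * ∏ j, g j := by
    rw [hfirst, ← mul_assoc, hgg, one_mul]
  rw [hA, hB]
  linear_combination g 0 * g (Fin.last n) * hsq

/-- A σ_z-string operator along a simple path anticommutes with the vertex operators at the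
two end points of the path and commutes with all other vertex operators: a pair of
`e`-particles is created at the end points. -/
theorem string_operator_creates_pair_of_charges {V₀ : Type*} [Fintype V₀] [DecidableEq V₀]
    (n : ℕ) (hn : 1 ≤ n) (v : Fin (n + 1) → V₀) (hv : Function.Injective v) :
    ∀ w : V₀,
      ((w = v 0 ∨ w = v (Fin.last n)) →
        Xop (vertexStar w) ∘ₗ Zop (pathEdges v) =
          - (Zop (pathEdges v) ∘ₗ Xop (vertexStar w))) ∧
      (w ≠ v 0 ∧ w ≠ v (Fin.last n) →
        Xop (vertexStar w) ∘ₗ Zop (pathEdges v) =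
          Zop (pathEdges v) ∘ₗ Xop (vertexStar w)) := by
  intro w
  have hends : v 0 ≠ v (Fin.last n) := hv.ne (by
    simp only [ne_eq, Fin.ext_iff, Fin.val_zero, Fin.val_last]
    omega)
  rw [Xop_comp_Zop, prod_sign_pathEdges hv]
  refine ⟨?_, fun ⟨h₀, h₁⟩ => by simp [h₀, h₁]⟩
  rintro (rfl | rfl)
  · rw [if_pos rfl, if_neg hends, mul_one]
    exact LinearMap.ext fun f => neg_one_smul ℂ (Zop _ (Xop _ f))
  · rw [if_neg hends.symm, if_pos rfl, one_mul]
    exact LinearMap.ext fun f => neg_one_smul ℂ (Zop _ (Xop _ f))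
end
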